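/- arXiv:0910.2506 — 2 statements merged into one kernel-verified Lean document; each statement's English description precedes it below -/
import Mathlib

section
/- Saito–Ziegler criterion with integer multiplicities (Abe): Let A be a finite central arrangement in an ℓ-dimensional Euclidean space V, m : A → ℤ an arbitrary multiplicity, x₁, …, x_ℓ a basis of V*, and Q^m := ∏_{H∈A} α_H^{m(H)}. Then ω₁, …, ω_ℓ ∈ Ω(A,m) form an S-basis of Ω(A,m) if and only if Q^m (ω₁ ∧ ⋯ ∧ ω_ℓ) = c · dx₁ ∧ dx₂ ∧ ⋯ ∧ dx_ℓ for some nonzero real constant c. -/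
open MvPolynomial

noncomputable section CoxeterFormalization

/-! ### The ambient rings: `S = Sym(V*)`, `F = Frac(S)`, rational 1-forms.

We model the `ℓ`-dimensional Euclidean space `V` as `ℝ^ℓ` with its standard
(orthonormal) coordinates, so that `S = ℝ[x_0, …, x_{ℓ-1}]`, and a rational
differential 1-form `ω = Σ ω_x dx_x` (equivalently, a rational derivation
`ξ = Σ ξ_x ∂_x`) is recorded by its component vector `(ω_x)_x : Fin ℓ → F`. -/

abbrev Spoly (ℓ : ℕ) := MvPolynomial (Fin ℓ) ℝ
abbrev Ffield (ℓ : ℕ) := FractionRing (Spoly ℓ)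
abbrev OmF (ℓ : ℕ) := Fin ℓ → Ffield ℓ

variable {ℓ t : ℕ}

/-- The image of `S` in `F`: the "regular" (polynomial) rational functions. -/
def Sreg (ℓ : ℕ) : Set (Ffield ℓ) := Set.range (algebraMap (Spoly ℓ) (Ffield ℓ))

def toF (p : Spoly ℓ) : Ffield ℓ := algebraMap (Spoly ℓ) (Ffield ℓ) p

/-- The linear form `α = Σ a_x · x_x ∈ V*` attached to a normal vector `a`. -/
def linForm (a : Fin ℓ → ℝ) : Spoly ℓ := ∑ x, MvPolynomial.C (a x) * MvPolynomial.X x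

def linF (a : Fin ℓ → ℝ) : Ffield ℓ := toF (linForm a)

def cF (r : ℝ) : Ffield ℓ := toF (MvPolynomial.C r)

def XF (x : Fin ℓ) : Ffield ℓ := toF (MvPolynomial.X x)

/-- `Q = ∏_{H ∈ A} α_H`, as an element of `F`. -/
def QF (A : Finset (Fin ℓ → ℝ)) : Ffield ℓ := toF (∏ a ∈ A, linForm a)

/-- `Q^m = ∏_{H ∈ A} α_H^{m(H)}` for an integral multiplicity `m`. -/
def QmF (A : Finset (Fin ℓ → ℝ)) (m : (Fin ℓ → ℝ) → ℤ) : Ffield ℓ :=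
  ∏ a ∈ A, linF a ^ m a

/-- Ziegler's module `Ω(A,∞)` of logarithmic 1-forms:
`Q^N ω` and `(Q/α_H)^N dα_H ∧ ω` regular for `N ≫ 0`.  The wedge
`dα_H ∧ ω` is recorded by its components `a_x ω_y - a_y ω_x`. -/
def OmegaInf (A : Finset (Fin ℓ → ℝ)) : Set (OmF ℓ) :=
  {ω | ∃ N : ℕ,
    (∀ x, QF A ^ N * ω x ∈ Sreg ℓ) ∧
    ∀ a ∈ A, ∀ x y,
      (QF A / linF a) ^ N * (cF (a x) * ω y - cF (a y) * ω x) ∈ Sreg ℓ}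

/-- `Ω(A,m)` for an arbitrary multiplicity `m : A → ℤ`: those `ω ∈ Ω(A,∞)` with
`(Q/α_H)^N α_H^{m(H)} I*(dα_H, ω) ∈ S` for `N ≫ 0`; here
`I*(dα_H, ω) = Σ_x a_x ω_x` (the coordinates are orthonormal). -/
def OmegaMult (A : Finset (Fin ℓ → ℝ)) (m : (Fin ℓ → ℝ) → ℤ) : Set (OmF ℓ) :=
  {ω ∈ OmegaInf A | ∃ N : ℕ,
    ∀ a ∈ A, (QF A / linF a) ^ N * linF a ^ m a * (∑ x, cF (a x) * ω x) ∈ Sreg ℓ}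

/-! ### The action of `GL_ℓ(ℝ)` on `S`, `F` and on component vectors. -/

/-- Substitution `x_i ↦ Σ_j M_{i j} x_j`, i.e. `f ↦ f ∘ M`. -/
def matSub (M : Matrix (Fin ℓ) (Fin ℓ) ℝ) : Spoly ℓ →ₐ[ℝ] Spoly ℓ :=
  MvPolynomial.aeval fun x => ∑ y, MvPolynomial.C (M x y) * MvPolynomial.X y

lemma matSub_comp (M N : Matrix (Fin ℓ) (Fin ℓ) ℝ) :
    (matSub M).comp (matSub N) = matSub (N * M) := by
  apply MvPolynomial.algHom_ext
  intro x
  simp only [matSub, AlgHom.coe_comp, Function.comp_apply, aeval_X, map_sum, map_mul, aeval_C,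
    Matrix.mul_apply, C_mul, Finset.sum_mul, Finset.mul_sum, MvPolynomial.algebraMap_eq,
    mul_assoc]
  rw [Finset.sum_comm]

lemma matSub_one : matSub (1 : Matrix (Fin ℓ) (Fin ℓ) ℝ) = AlgHom.id ℝ (Spoly ℓ) := by
  apply MvPolynomial.algHom_ext
  intro x
  simp [matSub, Matrix.one_apply, apply_ite MvPolynomial.C, ite_mul, Finset.sum_ite_eq]

lemma matSub_injective (g : Matrix.GeneralLinearGroup (Fin ℓ) ℝ) :
    Function.Injective (matSub (↑g : Matrix (Fin ℓ) (Fin ℓ) ℝ)) := by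
  intro p q h
  have h3 : (matSub (↑g⁻¹ : Matrix (Fin ℓ) (Fin ℓ) ℝ)).comp
      (matSub (↑g : Matrix (Fin ℓ) (Fin ℓ) ℝ)) = AlgHom.id ℝ (Spoly ℓ) := by
    rw [matSub_comp]
    have h1 : ((↑g : Matrix (Fin ℓ) (Fin ℓ) ℝ) * (↑g⁻¹ : Matrix (Fin ℓ) (Fin ℓ) ℝ))
        = (1 : Matrix (Fin ℓ) (Fin ℓ) ℝ) := by
      rw [← Units.val_mul]; simp
    rw [h1, matSub_one]
  have h2 := congrArg (matSub (↑g⁻¹ : Matrix (Fin ℓ) (Fin ℓ) ℝ)) h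
  rwa [← AlgHom.comp_apply, ← AlgHom.comp_apply, h3, AlgHom.id_apply, AlgHom.id_apply] at h2

/-- The action of `g ∈ GL_ℓ(ℝ)` on rational functions, `f ↦ f ∘ g⁻¹`. -/
def fAct (g : Matrix.GeneralLinearGroup (Fin ℓ) ℝ) : Ffield ℓ →+* Ffield ℓ :=
  IsFractionRing.lift (g :=
    (algebraMap (Spoly ℓ) (Ffield ℓ)).comp
      (matSub (↑g⁻¹ : Matrix (Fin ℓ) (Fin ℓ) ℝ)).toRingHom)
    ((IsFractionRing.injective (Spoly ℓ) (Ffield ℓ)).comp (matSub_injective g⁻¹))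

/-- The natural action of an **orthogonal** `g` on the component vector of a
differential 1-form (equivalently, of a derivation): `(g·v)_x = Σ_y g_{x y} · g(v_y)`. -/
def vecAct (g : Matrix.GeneralLinearGroup (Fin ℓ) ℝ) (v : OmF ℓ) : OmF ℓ :=
  fun x => ∑ y, cF ((↑g : Matrix (Fin ℓ) (Fin ℓ) ℝ) x y) * fAct g (v y)

/-- `W`-invariant component vectors (1-forms/derivations). -/
def InvVec (W : Subgroup (Matrix.GeneralLinearGroup (Fin ℓ) ℝ)) : Set (OmF ℓ) :=
  {ω | ∀ g ∈ W, vecAct g ω = ω}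

/-- `Ω(A,∞)^W`. -/
def OmegaInfW (A : Finset (Fin ℓ → ℝ)) (W : Subgroup (Matrix.GeneralLinearGroup (Fin ℓ) ℝ)) :
    Set (OmF ℓ) := OmegaInf A ∩ InvVec W

/-- `Ω(A,m)^W = Ω(A,m) ∩ Ω(A,∞)^W`. -/
def OmegaMultW (A : Finset (Fin ℓ → ℝ)) (W : Subgroup (Matrix.GeneralLinearGroup (Fin ℓ) ℝ))
    (m : (Fin ℓ → ℝ) → ℤ) : Set (OmF ℓ) := OmegaMult A m ∩ InvVec W

/-- `W`-invariant polynomials. -/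
def InvPoly (W : Subgroup (Matrix.GeneralLinearGroup (Fin ℓ) ℝ)) : Set (Spoly ℓ) :=
  {p | ∀ g ∈ W, matSub (↑g : Matrix (Fin ℓ) (Fin ℓ) ℝ) p = p}

/-- The invariant ring `R = S^W`, viewed inside `F`. -/
def RF (W : Subgroup (Matrix.GeneralLinearGroup (Fin ℓ) ℝ)) : Set (Ffield ℓ) :=
  toF '' InvPoly W

/-- The orthogonal reflection through the hyperplane `ker⟨a, ·⟩`. -/
def reflMat (a : Fin ℓ → ℝ) : Matrix (Fin ℓ) (Fin ℓ) ℝ :=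
  1 - (2 / ∑ x, a x * a x) • Matrix.vecMulVec a a

/-! ### Block (irreducible-factor) structure. -/

/-- A polynomial involving only the variables of the block `i` (w.r.t. the block
assignment `blk : Fin ℓ → Fin t`). -/
def blockPoly (blk : Fin ℓ → Fin t) (i : Fin t) (p : Spoly ℓ) : Prop :=
  ∀ m ∈ p.support, ∀ x ∈ Finsupp.support m, blk x = i

/-- Rational functions in the variables of block `i` only. -/
def blockFrac (blk : Fin ℓ → Fin t) (i : Fin t) : Set (Ffield ℓ) :=
  {y | ∃ p q : Spoly ℓ, blockPoly blk i p ∧ blockPoly blk i q ∧ q ≠ 0 ∧ y * toF q = toF p}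

/-- A component vector belonging to the factor `V[i]`:  components outside block `i`
vanish and all components are rational functions of the block-`i` variables. -/
def BlockVec (blk : Fin ℓ → Fin t) (i : Fin t) (ω : OmF ℓ) : Prop :=
  (∀ x, blk x ≠ i → ω x = 0) ∧ ∀ x, ω x ∈ blockFrac blk i

/-- All the data of a (not necessarily irreducible) Coxeter arrangement `A` in the
Euclidean space `V = ℝ^ℓ`, together with its decomposition into `t` irreducible
factors and a system of basic invariants:

* `A` is a finite set of hyperplanes, recorded by nonzero defining normal vectors,
  pairwise non-proportional;
* `W` is a finite subgroup of `GL_ℓ(ℝ)` consisting of orthogonal transformations,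
  generated by the reflections through the members of `A`, and `A` is exactly the
  set of reflecting hyperplanes of `W` (so `A` is the Coxeter arrangement of the
  finite real reflection group `W`);
* `blk` assigns to every coordinate its irreducible block `V[i]`, every hyperplane
  of `A` lies over a single block;
* `P c` (`c : Fin ℓ`) are basic invariants: homogeneous, `W`-invariant,
  algebraically independent generators of `R = S^W`, the invariants of the block `i`
  being those `P c` with `blk c = i` and involving only block-`i` variables;
* within each block `i` the invariant `P (top i)` has strictly largest degree
  (this uses irreducibility of the factors; it makes the primitive derivations
  `D[i] = ∂/∂P_{ℓ[i]}[i]` well defined up to constants). -/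
structure CoxeterSetup (ℓ t : ℕ) where
  A : Finset (Fin ℓ → ℝ)
  W : Subgroup (Matrix.GeneralLinearGroup (Fin ℓ) ℝ)
  hA0 : ∀ a ∈ A, a ≠ 0
  hAprop : ∀ a ∈ A, ∀ b ∈ A, (∃ c : ℝ, a = c • b) → a = b
  hWfin : (W : Set (Matrix.GeneralLinearGroup (Fin ℓ) ℝ)).Finite
  hWorth : ∀ g ∈ W, Matrix.transpose (↑g : Matrix (Fin ℓ) (Fin ℓ) ℝ) * (↑g : Matrix (Fin ℓ) (Fin ℓ) ℝ) = 1
  hrefl : ∀ a ∈ A, ∃ g ∈ W, (↑g : Matrix (Fin ℓ) (Fin ℓ) ℝ) = reflMat a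
  hhyp : ∀ g ∈ W, ∀ a : Fin ℓ → ℝ, a ≠ 0 → (↑g : Matrix (Fin ℓ) (Fin ℓ) ℝ) = reflMat a →
    ∃ b ∈ A, ∃ c : ℝ, a = c • b
  hgen : W = Subgroup.closure
    {g : Matrix.GeneralLinearGroup (Fin ℓ) ℝ | ∃ a ∈ A, (↑g : Matrix (Fin ℓ) (Fin ℓ) ℝ) = reflMat a}
  blk : Fin ℓ → Fin t
  hblkA : ∀ a ∈ A, ∃ i, ∀ x, a x ≠ 0 → blk x = i
  P : Fin ℓ → MvPolynomial (Fin ℓ) ℝ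
  deg : Fin ℓ → ℕ
  hdeg : ∀ c, 0 < deg c
  hPhom : ∀ c, (P c).IsHomogeneous (deg c)
  hPblock : ∀ c, blockPoly blk (blk c) (P c)
  hPinv : ∀ c, P c ∈ InvPoly W
  hPind : AlgebraicIndependent ℝ P
  hPgen : ∀ p : Spoly ℓ, p ∈ InvPoly W ↔ p ∈ Algebra.adjoin ℝ (Set.range P)
  top : Fin t → Fin ℓ
  htop : ∀ i, blk (top i) = i
  htopdeg : ∀ i c, blk c = i → c ≠ top i → deg c < deg (top i)

/-! ### Primitive derivations and the connection `∇_D`. -/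

/-- The covariant derivative `∇_D` on rational 1-forms: since `∇_D (dx_x) = 0`,
it acts componentwise, `∇_D(Σ f_x dx_x) = Σ D(f_x) dx_x`. -/
def nabVec (D : Derivation ℝ (Ffield ℓ) (Ffield ℓ)) (ω : OmF ℓ) : OmF ℓ :=
  fun x => D (ω x)

/-- `T = ker (D : R → R)`, viewed inside `F`. -/
def TF (W : Subgroup (Matrix.GeneralLinearGroup (Fin ℓ) ℝ))
    (D : Derivation ℝ (Ffield ℓ) (Ffield ℓ)) : Set (Ffield ℓ) :=
  {y ∈ RF W | D y = 0}

/-- The differential `dP` of a polynomial, as a component vector: `(dP)_x = ∂P/∂x_x`. -/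
def dPoly (p : Spoly ℓ) : OmF ℓ := fun x => toF (MvPolynomial.pderiv x p)

/-! ### Freeness of a submodule over a subring of coefficients. -/

/-- `v : ι → M` is a basis of the sub-`C`-module `Mod ⊆ M` over the coefficient
set `C ⊆ F`: the members of the family lie in `Mod`, every element of `Mod`
is a finite `C`-linear combination of them, and they are linearly independent
over `C`. -/
def IsBasisOver {ℓ : ℕ} {ι M : Type*} [AddCommMonoid M] [Module (Ffield ℓ) M]
    (C : Set (Ffield ℓ)) (Mod : Set M) (v : ι → M) : Prop :=
  (∀ j, v j ∈ Mod) ∧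
  (∀ ω ∈ Mod, ∃ c : ι →₀ Ffield ℓ, (∀ j, c j ∈ C) ∧ ω = c.sum fun j a => a • v j) ∧
  (∀ c : ι →₀ Ffield ℓ, (∀ j, c j ∈ C) → (c.sum fun j a => a • v j) = 0 → c = 0)

/-! ### Order of poles along a hyperplane. -/

/-- The localization `S_{(α)}` of `S` at the prime ideal `(α)`, viewed in `F`:
fractions with denominator prime to `α`. -/
def Sloc (a : Fin ℓ → ℝ) : Set (Ffield ℓ) :=
  {y | ∃ p q : Spoly ℓ, ¬ linForm a ∣ q ∧ y * toF q = toF p}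

/-- `ordEq a f k` says `ord_α(f) = k`, i.e. `k = min {j : α^j f ∈ S_{(α)}}`. -/
def ordEq (a : Fin ℓ → ℝ) (f : Ffield ℓ) (k : ℤ) : Prop :=
  linF a ^ k * f ∈ Sloc a ∧ ∀ j : ℤ, linF a ^ j * f ∈ Sloc a → k ≤ j

/-! ### Logarithmic derivation modules. -/

/-- The module `D(A,−∞)` of logarithmic derivations (Definition 4.1):
`Q^N ξ` regular and `(Q/α_H)^N ξ(β)` regular whenever `β ⊥ α_H`. -/
def DerInf (A : Finset (Fin ℓ → ℝ)) : Set (Derivation ℝ (Ffield ℓ) (Ffield ℓ)) :=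
  {ξ | ∃ N : ℕ,
    (∀ x, QF A ^ N * ξ (XF x) ∈ Sreg ℓ) ∧
    ∀ a ∈ A, ∀ b : Fin ℓ → ℝ, (∑ x, a x * b x) = 0 →
      (QF A / linF a) ^ N * ξ (linF b) ∈ Sreg ℓ}

/-- `D(A,m)` for a multiplicity `m : A → ℤ`:
`(Q/α_H)^N ξ(α_H) ∈ α_H^{m(H)} S` for `N ≫ 0`. -/
def DerMult (A : Finset (Fin ℓ → ℝ)) (m : (Fin ℓ → ℝ) → ℤ) :
    Set (Derivation ℝ (Ffield ℓ) (Ffield ℓ)) :=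
  {ξ ∈ DerInf A | ∃ N : ℕ, ∀ a ∈ A, ∃ p : Spoly ℓ,
    (QF A / linF a) ^ N * ξ (linF a) = linF a ^ m a * toF p}

/-- The component vector of a derivation: `ξ = Σ_x ξ(x_x) ∂_x`. -/
def derVec (ξ : Derivation ℝ (Ffield ℓ) (Ffield ℓ)) : OmF ℓ := fun x => ξ (XF x)

/-- `W`-invariant derivations (via the action on component vectors; the group
consists of orthogonal transformations). -/
def InvDer (W : Subgroup (Matrix.GeneralLinearGroup (Fin ℓ) ℝ)) :
    Set (Derivation ℝ (Ffield ℓ) (Ffield ℓ)) :=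
  {ξ | ∀ g ∈ W, vecAct g (derVec ξ) = derVec ξ}

/-- `D(A,−∞)^W`. -/
def DerInfW (A : Finset (Fin ℓ → ℝ)) (W : Subgroup (Matrix.GeneralLinearGroup (Fin ℓ) ℝ)) :
    Set (Derivation ℝ (Ffield ℓ) (Ffield ℓ)) := DerInf A ∩ InvDer W

/-- `D(A,m)^W = D(A,m) ∩ D(A,−∞)^W`. -/
def DerMultW (A : Finset (Fin ℓ → ℝ)) (W : Subgroup (Matrix.GeneralLinearGroup (Fin ℓ) ℝ))
    (m : (Fin ℓ → ℝ) → ℤ) : Set (Derivation ℝ (Ffield ℓ) (Ffield ℓ)) :=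
  DerMult A m ∩ InvDer W

/-- `I* : Ω_F → Der_F`, `I*(ω)(f) = I*(ω, df) = Σ_x ω_x ∂f/∂x_x`, defined using a
family `pd` of partial-derivative derivations of `F`. -/
def IstarDer (pd : Fin ℓ → Derivation ℝ (Ffield ℓ) (Ffield ℓ)) (ω : OmF ℓ) :
    Derivation ℝ (Ffield ℓ) (Ffield ℓ) :=
  ∑ x, ω x • pd x

/-- The covariant derivative `∇_D` on rational derivations: `(∇_D ξ)(α) = D(ξ(α))`
for `α ∈ V*`, i.e. `∇_D ξ = Σ_x D(ξ(x_x)) ∂_x`. -/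
def nabDer (pd : Fin ℓ → Derivation ℝ (Ffield ℓ) (Ffield ℓ))
    (D : Derivation ℝ (Ffield ℓ) (Ffield ℓ))
    (ξ : Derivation ℝ (Ffield ℓ) (Ffield ℓ)) : Derivation ℝ (Ffield ℓ) (Ffield ℓ) :=
  ∑ x, D (ξ (XF x)) • pd x

end CoxeterFormalization

section Statements

variable {ℓ t : ℕ}

/-! ### Linear forms -/

lemma eval_linForm (a v : Fin ℓ → ℝ) : MvPolynomial.eval v (linForm a) = ∑ x, a x * v x := by
  simp [linForm]

lemma sum_sq_ne_zero {a : Fin ℓ → ℝ} (ha : a ≠ 0) : ∑ x, a x * a x ≠ 0 :=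
  fun h => ha (dotProduct_self_eq_zero.1 h)

lemma linForm_ne_zero {a : Fin ℓ → ℝ} (ha : a ≠ 0) : linForm a ≠ 0 := by
  intro h
  apply sum_sq_ne_zero ha
  rw [← eval_linForm, h, map_zero]

lemma irreducible_linForm {a : Fin ℓ → ℝ} (ha : a ≠ 0) : Irreducible (linForm a) := by
  have h : linForm a = sumSMulX (Finsupp.equivFunOnFinite.symm a) := by
    simp [linForm, sumSMulX, Finsupp.linearCombination_apply, Finsupp.sum_fintype, smul_eq_C_mul]
  obtain ⟨x, hx⟩ := Function.ne_iff.1 ha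
  rw [h]
  refine irreducible_sumSMulX _ ⟨x, by simpa using hx⟩ ?_
  intro r hr
  exact isUnit_iff_ne_zero.2 fun h0 => hx (by simpa [h0] using hr x)

/-- A linear form divides another one only if they are proportional. -/
lemma eq_smul_of_linForm_dvd {a b : Fin ℓ → ℝ} (ha : a ≠ 0) (h : linForm a ∣ linForm b) :
    ∃ c : ℝ, b = c • a := by
  have hs := sum_sq_ne_zero ha
  set c : ℝ := (∑ x, a x * b x) / ∑ x, a x * a x with hc
  refine ⟨c, ?_⟩
  obtain ⟨k, hk⟩ := h
  set v : Fin ℓ → ℝ := b - c • a with hv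
  have h1 : a ⬝ᵥ v = 0 := by
    have : c * (a ⬝ᵥ a) = a ⬝ᵥ b := div_mul_cancel₀ _ hs
    rw [hv, dotProduct_sub, dotProduct_smul, smul_eq_mul, this, sub_self]
  have h2 : b ⬝ᵥ v = 0 := by
    have := congrArg (MvPolynomial.eval v) hk
    rw [map_mul, eval_linForm, eval_linForm] at this
    rw [dotProduct, this]
    exact mul_eq_zero_of_left h1 _
  have h3 : v ⬝ᵥ v = 0 := by
    nth_rewrite 1 [hv]
    rw [sub_dotProduct, smul_dotProduct, h1, h2, smul_zero, sub_zero]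
  exact sub_eq_zero.1 (dotProduct_self_eq_zero.1 h3)

lemma linF_ne_zero {a : Fin ℓ → ℝ} (ha : a ≠ 0) : linF a ≠ 0 :=
  (map_ne_zero_iff _ (IsFractionRing.injective (Spoly ℓ) (Ffield ℓ))).2 (linForm_ne_zero ha)

/-! ### Regular functions as a subring, constants as a ring homomorphism -/

/-- The subring of `F` formed by the polynomials. -/
noncomputable def regSubring (ℓ : ℕ) : Subring (Ffield ℓ) := (algebraMap (Spoly ℓ) (Ffield ℓ)).range

lemma mem_Sreg_iff {f : Ffield ℓ} : f ∈ Sreg ℓ ↔ f ∈ regSubring ℓ := Iff.rfl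

lemma toF_mem (p : Spoly ℓ) : toF p ∈ regSubring ℓ := ⟨p, rfl⟩

lemma linF_mem (a : Fin ℓ → ℝ) : linF a ∈ regSubring ℓ := toF_mem _

lemma cF_mem (r : ℝ) : cF r ∈ regSubring ℓ := toF_mem _

/-- `cF` as a ring homomorphism. -/
noncomputable def cFHom (ℓ : ℕ) : ℝ →+* Ffield ℓ := (algebraMap (Spoly ℓ) (Ffield ℓ)).comp MvPolynomial.C

lemma cF_eq (r : ℝ) : cF r = cFHom ℓ r := rfl

lemma det_mem_regSubring {M : Matrix (Fin ℓ) (Fin ℓ) (Ffield ℓ)}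
    (h : ∀ i j, M i j ∈ regSubring ℓ) : M.det ∈ regSubring ℓ := by
  rw [Matrix.det_apply]
  exact sum_mem fun σ _ => zsmul_mem (prod_mem fun i _ => h _ _) _

lemma mul_pow_mul_zpow_mem {K : Type*} [Field K] {R : Subring K} {y z : K} (hy : y ∈ R)
    (hz : z ∈ R) (hy0 : y ≠ 0) {n : ℕ} {k : ℤ} (hk : k.natAbs ≤ n) : (y * z) ^ n * y ^ k ∈ R := by
  obtain ⟨j, hj⟩ : ∃ j : ℕ, (j : ℤ) = n + k := ⟨(n + k).toNat, by omega⟩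
  have : (y * z) ^ n * y ^ k = z ^ n * y ^ j := by
    rw [← zpow_natCast y j, hj, zpow_add₀ hy0, zpow_natCast]
    ring
  rw [this]
  exact mul_mem (pow_mem hz _) (pow_mem hy _)

/-! ### The products `Q` and `Q / α_H` -/

/-- `Q / α_H` as a product of linear forms. -/
noncomputable def cofF (A : Finset (Fin ℓ → ℝ)) (a : Fin ℓ → ℝ) : Ffield ℓ := ∏ b ∈ A.erase a, linF b

lemma QF_eq (A : Finset (Fin ℓ → ℝ)) : QF A = ∏ b ∈ A, linF b := map_prod _ _ _

lemma QF_eq_mul_cofF {A : Finset (Fin ℓ → ℝ)} {a : Fin ℓ → ℝ} (ha : a ∈ A) :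
    QF A = linF a * cofF A a := by
  rw [QF_eq, cofF, Finset.mul_prod_erase _ _ ha]

lemma QF_div_linF {A : Finset (Fin ℓ → ℝ)} {a : Fin ℓ → ℝ} (ha : a ∈ A) (ha0 : a ≠ 0) :
    QF A / linF a = cofF A a := by
  rw [QF_eq_mul_cofF ha, mul_div_cancel_left₀ _ (linF_ne_zero ha0)]

lemma cofF_mem (A : Finset (Fin ℓ → ℝ)) (a : Fin ℓ → ℝ) : cofF A a ∈ regSubring ℓ :=
  prod_mem fun b _ => linF_mem b

lemma cofF_eq_mul {A : Finset (Fin ℓ → ℝ)} {a b : Fin ℓ → ℝ} (hb : b ∈ A) (hba : b ≠ a) :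
    cofF A a = linF b * ∏ c ∈ (A.erase a).erase b, linF c :=
  (Finset.mul_prod_erase _ _ (Finset.mem_erase.2 ⟨hba, hb⟩)).symm

lemma cofF_pow_mul_zpow_mem {A : Finset (Fin ℓ → ℝ)} {a b : Fin ℓ → ℝ} (hb : b ∈ A)
    (hba : b ≠ a) (hb0 : b ≠ 0) {n : ℕ} {k : ℤ} (hk : k.natAbs ≤ n) :
    cofF A a ^ n * linF b ^ k ∈ regSubring ℓ := by
  rw [cofF_eq_mul hb hba]
  exact mul_pow_mul_zpow_mem (linF_mem b) (prod_mem fun c _ => linF_mem c) (linF_ne_zero hb0) hk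

lemma cofF_pow_mul_prod_zpow_mem {A : Finset (Fin ℓ → ℝ)} (hA0 : ∀ a ∈ A, a ≠ 0)
    (a : Fin ℓ → ℝ) (m : (Fin ℓ → ℝ) → ℤ) {n : ℕ} (hn : ∀ b ∈ A, (m b).natAbs ≤ n) :
    cofF A a ^ n * ∏ b ∈ A.erase a, linF b ^ m b ∈ regSubring ℓ := by
  rw [cofF, ← Finset.prod_pow, ← Finset.prod_mul_distrib]
  refine prod_mem fun b hb => ?_
  have hb' := Finset.mem_of_mem_erase hb
  simpa using mul_pow_mul_zpow_mem (linF_mem b) (one_mem _) (linF_ne_zero (hA0 b hb')) (hn b hb')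

lemma QmF_eq_mul {A : Finset (Fin ℓ → ℝ)} {a : Fin ℓ → ℝ} (ha : a ∈ A) (m : (Fin ℓ → ℝ) → ℤ) :
    QmF A m = linF a ^ m a * ∏ b ∈ A.erase a, linF b ^ m b :=
  (Finset.mul_prod_erase _ (fun b => linF b ^ m b) ha).symm

lemma QmF_ne_zero {A : Finset (Fin ℓ → ℝ)} (hA0 : ∀ a ∈ A, a ≠ 0) (m : (Fin ℓ → ℝ) → ℤ) :
    QmF A m ≠ 0 :=
  Finset.prod_ne_zero_iff.2 fun a ha => zpow_ne_zero _ (linF_ne_zero (hA0 a ha))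

/-- The polynomials `Q / α_H`, `H ∈ A`, have no common factor, so a rational function whose
denominator divides a power of each of them is regular. -/
lemma mem_regSubring_of_cofF_pow_mul_mem {A : Finset (Fin ℓ → ℝ)} (hA : A.Nonempty)
    (hA0 : ∀ a ∈ A, a ≠ 0)
    (hAprop : ∀ a ∈ A, ∀ b ∈ A, (∃ c : ℝ, a = c • b) → a = b) {f : Ffield ℓ}
    (h : ∀ a ∈ A, ∃ N : ℕ, cofF A a ^ N * f ∈ regSubring ℓ) : f ∈ regSubring ℓ := by
  have hden : ∀ a ∈ A, ∃ N : ℕ,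
      (IsFractionRing.den (Spoly ℓ) f : Spoly ℓ) ∣ (∏ b ∈ A.erase a, linForm b) ^ N := by
    intro a ha
    obtain ⟨N, r, hr⟩ := h a ha
    refine ⟨N, (IsFractionRing.num_den_reduced (Spoly ℓ) f).symm.dvd_of_dvd_mul_right
      ⟨r, IsFractionRing.injective (Spoly ℓ) (Ffield ℓ) ?_⟩⟩
    have hf : algebraMap (Spoly ℓ) (Ffield ℓ) (IsFractionRing.num (Spoly ℓ) f) =
        f * algebraMap (Spoly ℓ) (Ffield ℓ) (IsFractionRing.den (Spoly ℓ) f) := by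
      have := IsLocalization.mk'_spec (Ffield ℓ) (IsFractionRing.num (Spoly ℓ) f)
        (IsFractionRing.den (Spoly ℓ) f)
      rw [IsFractionRing.mk'_num_den] at this
      exact this.symm
    have hc : algebraMap (Spoly ℓ) (Ffield ℓ) (∏ b ∈ A.erase a, linForm b) = cofF A a :=
      map_prod _ _ _
    rw [map_mul, map_mul, map_pow, hc, hf, hr]
    ring
  have hfactor : ∀ π : Spoly ℓ, Prime π → π ∣ (IsFractionRing.den (Spoly ℓ) f : Spoly ℓ) →
      ∀ a ∈ A, ∃ b ∈ A, b ≠ a ∧ π ∣ linForm b := by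
    intro π hπ hd a ha
    obtain ⟨N, hN⟩ := hden a ha
    obtain ⟨b, hb, hbd⟩ := hπ.exists_mem_finset_dvd (hπ.dvd_of_dvd_pow (hd.trans hN))
    exact ⟨b, Finset.mem_of_mem_erase hb, Finset.ne_of_mem_erase hb, hbd⟩
  have hunit : IsUnit (IsFractionRing.den (Spoly ℓ) f : Spoly ℓ) := by
    by_contra hu
    obtain ⟨π, hπ, hd⟩ := WfDvdMonoid.exists_irreducible_factor hu
      (nonZeroDivisors.ne_zero (IsFractionRing.den (Spoly ℓ) f).2)
    obtain ⟨a, ha⟩ := hA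
    obtain ⟨b, hb, -, hbd⟩ := hfactor π hπ.prime hd a ha
    obtain ⟨c, hc, hcb, hcd⟩ := hfactor π hπ.prime hd b hb
    have hbc : linForm b ∣ linForm c :=
      ((hπ.associated_of_dvd (irreducible_linForm (hA0 b hb)) hbd).dvd_iff_dvd_left).1 hcd
    exact hcb (hAprop c hc b hb (eq_smul_of_linForm_dvd (hA0 b hb) hbc))
  exact IsFractionRing.isInteger_of_isUnit_den hunit

/-! ### A frame adapted to a hyperplane -/

/-- The matrix whose row `k` is `a` and whose other rows are the projections of the standard
basis vectors to the orthogonal complement of `a`. -/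
noncomputable def frameMat (a : Fin ℓ → ℝ) (k : Fin ℓ) : Matrix (Fin ℓ) (Fin ℓ) ℝ :=
  Matrix.of fun i => if i = k then a else Pi.single i 1 - (a i / ∑ x, a x * a x) • a

lemma frameMat_self (a : Fin ℓ → ℝ) (k : Fin ℓ) : frameMat a k k = a := if_pos rfl

lemma frameMat_of_ne (a : Fin ℓ → ℝ) {i k : Fin ℓ} (h : i ≠ k) :
    frameMat a k i = Pi.single i 1 - (a i / ∑ x, a x * a x) • a := if_neg h

lemma det_frameMat (a : Fin ℓ → ℝ) (k : Fin ℓ) : (frameMat a k).det = a k := by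
  have h1 : ((1 : Matrix (Fin ℓ) (Fin ℓ) ℝ).updateRow k a).det = a k := by
    have := Matrix.det_updateRow_sum (1 : Matrix (Fin ℓ) (Fin ℓ) ℝ) k a
    rw [Matrix.det_one, smul_eq_mul, mul_one] at this
    rw [← this]
    congr 2
    ext x
    simp [Matrix.one_apply]
  rw [← h1]
  refine Matrix.det_eq_of_forall_row_eq_smul_add_const
    (fun i => if i = k then 0 else -(a i / ∑ x, a x * a x)) k (if_pos rfl) fun i j => ?_
  rcases eq_or_ne i k with rfl | h
  · simp [frameMat_self]
  · simp [frameMat_of_ne a h, h, Matrix.one_apply, Pi.single_apply, eq_comm, sub_eq_add_neg]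

lemma sum_mul_frameMat {a : Fin ℓ → ℝ} (ha : a ≠ 0) {i k : Fin ℓ} (h : i ≠ k) :
    ∑ x, a x * frameMat a k i x = 0 := by
  have hs := sum_sq_ne_zero ha
  change a ⬝ᵥ frameMat a k i = 0
  rw [frameMat_of_ne a h, dotProduct_sub, dotProduct_smul, dotProduct_single, mul_one, smul_eq_mul]
  exact sub_eq_zero.2 (div_mul_cancel₀ _ hs).symm

/-- Contraction with a vector orthogonal to `a` only involves `da ∧ ω`. -/
lemma sum_frameMat_mul {a : Fin ℓ → ℝ} (ha : a ≠ 0) {i k : Fin ℓ} (h : i ≠ k) (ω : OmF ℓ) :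
    ∑ x, cF (frameMat a k i x) * ω x =
      cF (∑ x, a x * a x)⁻¹ * ∑ x, cF (a x) * (cF (a x) * ω i - cF (a i) * ω x) := by
  have hs : (cFHom ℓ) (∑ x, a x * a x) ≠ 0 := (map_ne_zero _).2 (sum_sq_ne_zero ha)
  have h1 : ∑ x, cF (frameMat a k i x) * ω x =
      ω i - cF (a i / ∑ x, a x * a x) * ∑ x, cF (a x) * ω x := by
    simp only [frameMat_of_ne a h, cF_eq, Pi.sub_apply, Pi.smul_apply, smul_eq_mul, map_sub,
      map_mul, sub_mul, Finset.sum_sub_distrib, Finset.mul_sum, mul_assoc, Pi.single_apply,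
      apply_ite (cFHom ℓ), map_one, map_zero, ite_mul, one_mul, zero_mul, Finset.sum_ite_eq',
      Finset.mem_univ, if_true]
  have h2 : ∑ x, cF (a x) * (cF (a x) * ω i - cF (a i) * ω x) =
      cF (∑ x, a x * a x) * ω i - cF (a i) * ∑ x, cF (a x) * ω x := by
    simp only [cF_eq, map_sum, map_mul, mul_sub, Finset.sum_sub_distrib, Finset.mul_sum,
      Finset.sum_mul]
    congr 1
    · exact Finset.sum_congr rfl fun x _ => by ring
    · exact Finset.sum_congr rfl fun x _ => by ring
  rw [h1, h2]
  clear h1 h2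
  generalize ∑ x, a x * a x = s at hs ⊢
  simp only [cF_eq, map_div₀, map_inv₀]
  field_simp

/-! ### Determinants of families of logarithmic forms -/

lemma exists_cofF_pow_mul_mem {A : Finset (Fin ℓ → ℝ)} (hA0 : ∀ a ∈ A, a ≠ 0)
    {m : (Fin ℓ → ℝ) → ℤ} {ω : OmF ℓ} (hω : ω ∈ OmegaMult A m) {a : Fin ℓ → ℝ} (ha : a ∈ A) :
    ∃ N₀ : ℕ, ∀ N ≥ N₀,
      (∀ x y, cofF A a ^ N * (cF (a x) * ω y - cF (a y) * ω x) ∈ regSubring ℓ) ∧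
      cofF A a ^ N * (linF a ^ m a * ∑ x, cF (a x) * ω x) ∈ regSubring ℓ := by
  obtain ⟨⟨N₁, -, h₁⟩, N₂, h₂⟩ := hω
  have hmono : ∀ {M N : ℕ} {f : Ffield ℓ}, M ≤ N → cofF A a ^ M * f ∈ regSubring ℓ →
      cofF A a ^ N * f ∈ regSubring ℓ := by
    intro M N f hMN hf
    rw [← Nat.sub_add_cancel hMN, pow_add, mul_assoc]
    exact mul_mem (pow_mem (cofF_mem A a) _) hf
  refine ⟨max N₁ N₂, fun N hN => ⟨fun x y => ?_, ?_⟩⟩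
  · have := h₁ a ha x y
    rw [QF_div_linF ha (hA0 a ha)] at this
    exact hmono (le_trans (le_max_left _ _) hN) this
  · have := h₂ a ha
    rw [QF_div_linF ha (hA0 a ha), mul_assoc] at this
    exact hmono (le_trans (le_max_right _ _) hN) this

lemma exists_cofF_pow_mul_det_mem {A : Finset (Fin ℓ → ℝ)} (hA0 : ∀ a ∈ A, a ≠ 0)
    {m : (Fin ℓ → ℝ) → ℤ} {η : Fin ℓ → OmF ℓ} (hη : ∀ j, η j ∈ OmegaMult A m)
    {a : Fin ℓ → ℝ} (ha : a ∈ A) :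
    ∃ N : ℕ, cofF A a ^ N * (linF a ^ m a * (Matrix.of fun x j => η j x).det) ∈
      regSubring ℓ := by
  obtain ⟨k, hk⟩ := Function.ne_iff.1 (hA0 a ha)
  choose N₀ hN₀ using fun j => exists_cofF_pow_mul_mem hA0 (hη j) ha
  set N := Finset.univ.sup N₀
  have hN : ∀ j, N₀ j ≤ N := fun j => Finset.le_sup (Finset.mem_univ j)
  set B := (cFHom ℓ).mapMatrix (frameMat a k) * Matrix.of fun x j => η j x with hB
  have hdetB : B.det = cFHom ℓ (a k) * (Matrix.of fun x j => η j x).det := by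
    rw [hB, Matrix.det_mul, ← RingHom.map_det, det_frameMat]
  have hBapply : ∀ i j, B i j = ∑ x, cF (frameMat a k i x) * η j x := fun i j => by
    simp [hB, Matrix.mul_apply, cF_eq]
  have hmem := det_mem_regSubring (M := Matrix.of fun i j =>
    (cofF A a ^ N * if i = k then linF a ^ m a else 1) * B i j) (by
      intro i j
      rw [Matrix.of_apply, hBapply, mul_assoc]
      obtain ⟨h₁, h₂⟩ := hN₀ j N (hN j)
      rcases eq_or_ne i k with rfl | h
      · rw [if_pos rfl, frameMat_self]
        exact h₂
      · rw [if_neg h, one_mul, sum_frameMat_mul (hA0 a ha) h, mul_left_comm]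
        refine mul_mem (cF_mem _) ?_
        rw [Finset.mul_sum]
        refine sum_mem fun x _ => ?_
        rw [mul_left_comm]
        exact mul_mem (cF_mem _) (h₁ x i))
  rw [Matrix.det_mul_column, Finset.prod_mul_distrib, Finset.prod_const, ← pow_mul,
    Finset.prod_ite_eq' Finset.univ k, if_pos (Finset.mem_univ k), hdetB] at hmem
  refine ⟨N * (Finset.univ : Finset (Fin ℓ)).card, ?_⟩
  have hak : cFHom ℓ (a k) ≠ 0 := (map_ne_zero _).2 hk
  have := mul_mem (cF_mem (ℓ := ℓ) (a k)⁻¹) hmem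
  rw [cF_eq, map_inv₀] at this
  convert this using 1
  field_simp

/-- `Q^m · (η₁ ∧ ⋯ ∧ η_ℓ)` is regular for all `η₁, …, η_ℓ ∈ Ω(A,m)`. -/
lemma QmF_mul_det_mem {A : Finset (Fin ℓ → ℝ)} (hA0 : ∀ a ∈ A, a ≠ 0)
    (hAprop : ∀ a ∈ A, ∀ b ∈ A, (∃ c : ℝ, a = c • b) → a = b)
    {m : (Fin ℓ → ℝ) → ℤ} {η : Fin ℓ → OmF ℓ} (hη : ∀ j, η j ∈ OmegaMult A m) :
    QmF A m * (Matrix.of fun x j => η j x).det ∈ regSubring ℓ := by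
  rcases A.eq_empty_or_nonempty with rfl | hA
  · simp only [QmF, Finset.prod_empty, one_mul]
    refine det_mem_regSubring fun x j => ?_
    obtain ⟨⟨N, h, -⟩, -⟩ := hη j
    simpa [QF_eq, mem_Sreg_iff] using h x
  · refine mem_regSubring_of_cofF_pow_mul_mem hA hA0 hAprop fun a ha => ?_
    obtain ⟨N, hN⟩ := exists_cofF_pow_mul_det_mem hA0 hη ha
    have hm := cofF_pow_mul_prod_zpow_mem hA0 a m (n := ∑ b ∈ A, (m b).natAbs)
      fun b hb => Finset.single_le_sum (f := fun b => (m b).natAbs) (fun _ _ => Nat.zero_le _) hb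
    refine ⟨N + ∑ b ∈ A, (m b).natAbs, ?_⟩
    convert mul_mem hN hm using 1
    rw [QmF_eq_mul ha]
    ring

/-! ### Explicit elements of `Ω(A,m)` -/

/-- Multiples of constant forms lying in `Ω(A,m)`: the form is either parallel to `dα_H` with
coefficient of order `-m(H)` along `H`, or orthogonal to it with coefficient of order `0`. -/
lemma const_mem_OmegaMult {A : Finset (Fin ℓ → ℝ)} (hA0 : ∀ a ∈ A, a ≠ 0)
    {m : (Fin ℓ → ℝ) → ℤ} {K : ℕ} (hK : ∀ b ∈ A, (m b).natAbs ≤ K) {a : Fin ℓ → ℝ} (ha : a ∈ A)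
    {k : ℤ} {u : Fin ℓ → ℝ} (hu : u = a ∧ k = -m a ∨ ∑ x, a x * u x = 0 ∧ k = 0) :
    (fun x => cofF A a ^ K * linF a ^ k * cF (u x)) ∈ OmegaMult A m := by
  have ha0 := linF_ne_zero (hA0 a ha)
  have hkK : k.natAbs ≤ K := by
    rcases hu with ⟨-, rfl⟩ | ⟨-, rfl⟩
    · simpa using hK a ha
    · simp
  have hcof := fun b => cofF_mem A b
  refine ⟨⟨K, fun x => ?_, fun b hb x y => ?_⟩, K, fun b hb => ?_⟩
  · have := mul_pow_mul_zpow_mem (linF_mem a) (hcof a) ha0 hkK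
    rw [mem_Sreg_iff, QF_eq_mul_cofF ha]
    convert mul_mem (mul_mem (pow_mem (hcof a) K) this) (cF_mem (u x)) using 1
    ring
  · rw [mem_Sreg_iff, QF_div_linF hb (hA0 b hb)]
    have e : cofF A b ^ K * (cF (b x) * (cofF A a ^ K * linF a ^ k * cF (u y)) -
        cF (b y) * (cofF A a ^ K * linF a ^ k * cF (u x))) =
        cofF A b ^ K * linF a ^ k * (cofF A a ^ K * cF (b x * u y - b y * u x)) := by
      simp only [cF_eq, map_sub, map_mul]
      ring
    rw [e]
    have hr := mul_mem (pow_mem (hcof a) K) (cF_mem (b x * u y - b y * u x))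
    rcases eq_or_ne a b with rfl | hab
    · rcases hu with ⟨rfl, -⟩ | ⟨-, rfl⟩
      · simp [cF_eq, mul_comm, zero_mem]
      · rw [zpow_zero, mul_one]
        exact mul_mem (pow_mem (hcof _) K) hr
    · exact mul_mem (cofF_pow_mul_zpow_mem ha hab (hA0 a ha) hkK) hr
  · rw [mem_Sreg_iff, QF_div_linF hb (hA0 b hb)]
    have e : ∑ x, cF (b x) * (cofF A a ^ K * linF a ^ k * cF (u x)) =
        cofF A a ^ K * linF a ^ k * cF (∑ x, b x * u x) := by
      simp only [cF_eq, map_sum, map_mul, Finset.mul_sum]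
      exact Finset.sum_congr rfl fun x _ => by ring
    rw [e]
    rcases eq_or_ne a b with rfl | hab
    · rcases hu with ⟨rfl, rfl⟩ | ⟨h, -⟩
      · convert mul_mem (mul_mem (pow_mem (hcof u) K) (pow_mem (hcof u) K))
          (cF_mem (∑ x, u x * u x)) using 1
        rw [zpow_neg]
        field_simp
      · simp [h, cF_eq, zero_mem]
    · have h₁ := cofF_pow_mul_zpow_mem ha hab (hA0 a ha) hkK
      have h₂ := cofF_pow_mul_zpow_mem hb hab.symm (hA0 b hb) (hK b hb)
      convert mul_mem (mul_mem h₁ h₂) (cF_mem (∑ x, b x * u x)) using 1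
      ring

/-- For each `H ∈ A` there are `η₁, …, η_ℓ ∈ Ω(A,m)` such that `Q^m · (η₁ ∧ ⋯ ∧ η_ℓ)` is nonzero
and is prime to `α_H`. -/
lemma exists_family_det_eq {A : Finset (Fin ℓ → ℝ)} (hA0 : ∀ a ∈ A, a ≠ 0)
    {m : (Fin ℓ → ℝ) → ℤ} {K : ℕ} (hK : ∀ b ∈ A, (m b).natAbs ≤ K) {a : Fin ℓ → ℝ} (ha : a ∈ A) :
    ∃ η : Fin ℓ → OmF ℓ, (∀ j, η j ∈ OmegaMult A m) ∧ ∃ r : ℝ, r ≠ 0 ∧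
      QmF A m * (Matrix.of fun x j => η j x).det =
        cofF A a ^ (K * ℓ) * (∏ b ∈ A.erase a, linF b ^ m b) * cF r := by
  obtain ⟨k, hk⟩ := Function.ne_iff.1 (hA0 a ha)
  have ha0 := linF_ne_zero (hA0 a ha)
  refine ⟨fun j x => cofF A a ^ K * linF a ^ (if j = k then -m a else 0) * cF (frameMat a k j x),
    fun j => const_mem_OmegaMult hA0 hK ha ?_, a k, hk, ?_⟩
  · rcases eq_or_ne j k with rfl | h
    · exact Or.inl ⟨frameMat_self a j, if_pos rfl⟩
    · exact Or.inr ⟨sum_mul_frameMat (hA0 a ha) h, if_neg h⟩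
  · have hdet := Matrix.det_mul_column
      (fun j => cofF A a ^ K * linF a ^ (if j = k then -m a else 0))
      ((cFHom ℓ).mapMatrix (frameMat a k))
    rw [← RingHom.map_det, det_frameMat, Finset.prod_mul_distrib, Finset.prod_const,
      Finset.card_univ, Fintype.card_fin, ← pow_mul] at hdet
    have hite : ∀ j, linF a ^ (if j = k then -m a else 0) =
        if j = k then linF a ^ (-m a) else 1 := fun j => by split_ifs <;> simp
    simp only [hite] at hdet ⊢
    rw [Finset.prod_ite_eq' Finset.univ k, if_pos (Finset.mem_univ k)] at hdet
    rw [← Matrix.det_transpose]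
    have e : (Matrix.of fun x j => cofF A a ^ K * (if j = k then linF a ^ (-m a) else 1) *
        cF (frameMat a k j x)).transpose = Matrix.of fun j x =>
        cofF A a ^ K * (if j = k then linF a ^ (-m a) else 1) *
          (cFHom ℓ).mapMatrix (frameMat a k) j x := rfl
    rw [e, hdet, QmF_eq_mul ha, zpow_neg, cF_eq]
    field_simp

/-! ### Expansion with respect to a basis -/

lemma exists_det_eq_mul_of_isBasisOver {Mod : Set (OmF ℓ)} {ω η : Fin ℓ → OmF ℓ}
    (hω : IsBasisOver (Sreg ℓ) Mod ω) (hη : ∀ j, η j ∈ Mod) :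
    ∃ g ∈ regSubring ℓ, (Matrix.of fun x j => η j x).det =
      (Matrix.of fun x j => ω j x).det * g := by
  choose c hc hsum using fun j => hω.2.1 (η j) (hη j)
  refine ⟨(Matrix.of fun i j => c j i).det, det_mem_regSubring fun i j => hc j i, ?_⟩
  rw [← Matrix.det_mul]
  congr 1
  ext x j
  rw [Matrix.of_apply, hsum j, Finsupp.sum_fintype _ _ (fun i => zero_smul (Ffield ℓ) (ω i))]
  simp [Matrix.mul_apply, mul_comm]

/-- If some family in `Ω(A,m)` has `Q^m`-normalized determinant a nonzero constant, it is a
basis by Cramer's rule. -/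
lemma isBasisOver_of_det_eq {A : Finset (Fin ℓ → ℝ)} (hA0 : ∀ a ∈ A, a ≠ 0)
    (hAprop : ∀ a ∈ A, ∀ b ∈ A, (∃ c : ℝ, a = c • b) → a = b)
    {m : (Fin ℓ → ℝ) → ℤ} {ω : Fin ℓ → OmF ℓ} (hω : ∀ j, ω j ∈ OmegaMult A m) {c : ℝ}
    (hc : c ≠ 0) (hdet : QmF A m * (Matrix.of fun x j => ω j x).det = cF c) :
    IsBasisOver (Sreg ℓ) (OmegaMult A m) ω := by
  set M : Matrix (Fin ℓ) (Fin ℓ) (Ffield ℓ) := Matrix.of fun x j => ω j x with hM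
  have hcF : cF (ℓ := ℓ) c ≠ 0 := (map_ne_zero (cFHom ℓ)).2 hc
  have hM0 : M.det ≠ 0 := right_ne_zero_of_mul (hdet.trans_ne hcF)
  have hlin : ∀ f : Fin ℓ →₀ Ffield ℓ, (f.sum fun j a => a • ω j) = M.mulVec f := by
    intro f
    rw [Finsupp.sum_fintype _ _ (fun i => zero_smul (Ffield ℓ) (ω i))]
    ext x
    simp [Matrix.mulVec, dotProduct, hM, mul_comm]
  refine ⟨hω, fun η hη => ?_, fun f _ hf => ?_⟩
  · refine ⟨Finsupp.equivFunOnFinite.symm fun j => cF c⁻¹ * (QmF A m * M.cramer η j),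
      fun j => ?_, ?_⟩
    · refine mul_mem (cF_mem _) ?_
      have := QmF_mul_det_mem hA0 hAprop (η := Function.update ω j η) (m := m) fun i => by
        rcases eq_or_ne i j with rfl | h
        · simpa using hη
        · simpa [h] using hω i
      rw [Matrix.cramer_apply]
      convert this using 3
      ext x i
      rcases eq_or_ne i j with rfl | h
      · simp
      · simp [h, hM]
    · rw [hlin]
      have hv : (Finsupp.equivFunOnFinite.symm fun j => cF c⁻¹ * (QmF A m * M.cramer η j) :
          Fin ℓ → Ffield ℓ) = (cF c⁻¹ * QmF A m) • M.cramer η := by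
        ext j
        simp [mul_assoc]
      rw [hv, Matrix.mulVec_smul, Matrix.mulVec_cramer, smul_smul, mul_assoc, hdet]
      simp [cF_eq, hc]
  · rw [hlin] at hf
    exact DFunLike.coe_injective (Matrix.eq_zero_of_mulVec_eq_zero hM0 hf)

lemma det_eq_of_isBasisOver {A : Finset (Fin ℓ → ℝ)} (hA0 : ∀ a ∈ A, a ≠ 0)
    (hAprop : ∀ a ∈ A, ∀ b ∈ A, (∃ c : ℝ, a = c • b) → a = b)
    {m : (Fin ℓ → ℝ) → ℤ} {ω : Fin ℓ → OmF ℓ} (hω : IsBasisOver (Sreg ℓ) (OmegaMult A m) ω) :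
    ∃ c : ℝ, c ≠ 0 ∧ QmF A m * (Matrix.of fun x j => ω j x).det = cF c := by
  set f := QmF A m * (Matrix.of fun x j => ω j x).det with hf
  have hfmem : f ∈ regSubring ℓ := QmF_mul_det_mem hA0 hAprop hω.1
  have hinv : f ≠ 0 ∧ f⁻¹ ∈ regSubring ℓ := by
    rcases A.eq_empty_or_nonempty with rfl | hA
    · obtain ⟨g, hg, hdet⟩ := exists_det_eq_mul_of_isBasisOver hω
        (η := fun j => Pi.single j 1) fun j => by
          refine ⟨⟨0, fun x => ?_, by simp⟩, 0, by simp⟩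
          rw [pow_zero, one_mul, Pi.single_apply]
          split_ifs
          exacts [one_mem (regSubring ℓ), zero_mem (regSubring ℓ)]
      have h1 : (Matrix.of fun x j => (Pi.single j 1 : OmF ℓ) x) = 1 := by
        ext x j
        simp [Matrix.one_apply, Pi.single_apply]
      have hfg : f * g = 1 := by
        rw [hf, QmF, Finset.prod_empty, one_mul, ← hdet, h1, Matrix.det_one]
      exact ⟨left_ne_zero_of_mul_eq_one hfg, by rwa [inv_eq_of_mul_eq_one_right hfg]⟩
    · have hK : ∀ b ∈ A, (m b).natAbs ≤ ∑ b ∈ A, (m b).natAbs := fun b hb =>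
        Finset.single_le_sum (f := fun b => (m b).natAbs) (fun _ _ => Nat.zero_le _) hb
      set K := ∑ b ∈ A, (m b).natAbs
      have key : ∀ a ∈ A, ∃ g ∈ regSubring ℓ, ∃ r : ℝ, r ≠ 0 ∧
          f * g = cofF A a ^ (K * ℓ) * (∏ b ∈ A.erase a, linF b ^ m b) * cF r := by
        intro a ha
        obtain ⟨η, hη, r, hr, hdet⟩ := exists_family_det_eq hA0 hK ha
        obtain ⟨g, hg, hωη⟩ := exists_det_eq_mul_of_isBasisOver hω hη
        exact ⟨g, hg, r, hr, by rw [← hdet, hωη, hf, mul_assoc]⟩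
      have hprod : ∀ a, ∏ b ∈ A.erase a, linF b ^ m b ≠ 0 := fun a =>
        Finset.prod_ne_zero_iff.2 fun b hb =>
          zpow_ne_zero _ (linF_ne_zero (hA0 b (Finset.mem_of_mem_erase hb)))
      have hcof : ∀ a, cofF A a ≠ 0 := fun a =>
        Finset.prod_ne_zero_iff.2 fun b hb => linF_ne_zero (hA0 b (Finset.mem_of_mem_erase hb))
      have hf0 : f ≠ 0 := by
        obtain ⟨a, ha⟩ := hA
        obtain ⟨g, -, r, hr, h⟩ := key a ha
        have hr' : cF (ℓ := ℓ) r ≠ 0 := (map_ne_zero (cFHom ℓ)).2 hr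
        exact left_ne_zero_of_mul
          (h.trans_ne (mul_ne_zero (mul_ne_zero (pow_ne_zero _ (hcof a)) (hprod a)) hr'))
      refine ⟨hf0, mem_regSubring_of_cofF_pow_mul_mem hA hA0 hAprop fun a ha => ?_⟩
      obtain ⟨g, hg, r, hr, h⟩ := key a ha
      have hr' : cFHom ℓ r ≠ 0 := (map_ne_zero (cFHom ℓ)).2 hr
      have hneg := cofF_pow_mul_prod_zpow_mem hA0 a (fun b => -m b) (n := K)
        fun b hb => by simpa using hK b hb
      simp only [zpow_neg, Finset.prod_inv_distrib] at hneg
      refine ⟨K * ℓ + K, ?_⟩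
      convert mul_mem (mul_mem hneg hg) (cF_mem r⁻¹) using 1
      rw [cF_eq, map_inv₀]
      rw [cF_eq] at h
      have hp := hprod a
      field_simp
      linear_combination -(cofF A a ^ K) * h
  obtain ⟨p, hp⟩ := hfmem
  obtain ⟨q, hq⟩ := hinv.2
  have hpq : p * q = 1 := IsFractionRing.injective (Spoly ℓ) (Ffield ℓ) (by
    rw [map_mul, hp, hq, map_one, mul_inv_cancel₀ hinv.1])
  obtain ⟨c, hc, rfl⟩ := isUnit_iff_eq_C_of_isReduced.1 (IsUnit.of_mul_eq_one q hpq)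
  exact ⟨c, hc.ne_zero, hp.symm⟩

/-- Proposition 2.1 (2), the Saito–Ziegler criterion of Abe:
`ω₁, …, ω_ℓ ∈ Ω(A,m)` form an `S`-basis of `Ω(A,m)` iff
`Q^m (ω₁ ∧ ⋯ ∧ ω_ℓ) = c · dx₁ ∧ ⋯ ∧ dx_ℓ` with `c ∈ ℝˣ`. -/
theorem stmt3 (A : Finset (Fin ℓ → ℝ))
    (hA0 : ∀ a ∈ A, a ≠ 0)
    (hAprop : ∀ a ∈ A, ∀ b ∈ A, (∃ c : ℝ, a = c • b) → a = b)
    (m : (Fin ℓ → ℝ) → ℤ) (ω : Fin ℓ → OmF ℓ) (hω : ∀ j, ω j ∈ OmegaMult A m) :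
    IsBasisOver (Sreg ℓ) (OmegaMult A m) ω ↔
      ∃ c : ℝ, c ≠ 0 ∧ QmF A m * (Matrix.of fun x j => ω j x).det = cF c := by
  exact ⟨det_eq_of_isBasisOver hA0 hAprop,
    fun ⟨_, hc, hdet⟩ => isBasisOver_of_det_eq hA0 hAprop hω hc hdet⟩

end Statements
end

section
/- Let A be a (not necessarily irreducible) Coxeter arrangement with Coxeter group W, R := S^W, D the primitive derivation and T := ker(D : R → R). Then for every i = 1, …, t one has R = T[P[i]], i.e. R is generated as a T-algebra by the single element P[i] := P_{ℓ[i]}[i]. -/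
open MvPolynomial

section Statements

variable {ℓ t : ℕ}

/-- The `W`-invariant polynomials, as a subring of `S`. -/
def invSubring (W : Subgroup (Matrix.GeneralLinearGroup (Fin ℓ) ℝ)) : Subring (Spoly ℓ) where
  carrier := InvPoly W
  mul_mem' ha hb g hg := by rw [map_mul, ha g hg, hb g hg]
  one_mem' _ _ := map_one _
  add_mem' ha hb g hg := by rw [map_add, ha g hg, hb g hg]
  zero_mem' _ _ := map_zero _
  neg_mem' ha g hg := by rw [map_neg, ha g hg]

lemma coe_map_invSubring (W : Subgroup (Matrix.GeneralLinearGroup (Fin ℓ) ℝ)) :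
    (((invSubring W).map (algebraMap (Spoly ℓ) (Ffield ℓ)) : Subring (Ffield ℓ)) :
      Set (Ffield ℓ)) = RF W := rfl

lemma toF_add (p q : Spoly ℓ) : toF (p + q) = toF p + toF q := map_add _ p q

lemma toF_mul (p q : Spoly ℓ) : toF (p * q) = toF p * toF q := map_mul _ p q

lemma toF_sub (p q : Spoly ℓ) : toF (p - q) = toF p - toF q := map_sub _ p q

lemma toF_algebraMap (r : ℝ) :
    toF (algebraMap ℝ (Spoly ℓ) r) = algebraMap ℝ (Ffield ℓ) r :=
  (IsScalarTower.algebraMap_apply ℝ (Spoly ℓ) (Ffield ℓ) r).symm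

lemma Derivation.finsetSum_apply {ι R A M : Type*} [CommSemiring R] [CommSemiring A]
    [Algebra R A] [AddCommMonoid M] [Module A M] [Module R M] (s : Finset ι)
    (d : ι → Derivation R A M) (a : A) : (∑ i ∈ s, d i) a = ∑ i ∈ s, d i a := by
  rw [← Derivation.coeFnAddMonoidHom_apply, map_sum, Finset.sum_apply]
  rfl

lemma CoxeterSetup.top_injective (cox : CoxeterSetup ℓ t) : Function.Injective cox.top :=
  Function.LeftInverse.injective cox.htop

/-- The primitive derivation sends `P (top j)` to `1`. -/
lemma CoxeterSetup.sum_apply_top (cox : CoxeterSetup ℓ t)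
    (DFi : Fin t → Derivation ℝ (Ffield ℓ) (Ffield ℓ))
    (hDFi : ∀ i c, DFi i (toF (cox.P c)) = if c = cox.top i then 1 else 0) (j : Fin t) :
    (∑ i, DFi i) (toF (cox.P (cox.top j))) = 1 := by
  simp [Derivation.finsetSum_apply, hDFi, cox.top_injective.eq_iff]

/-- The primitive derivation kills every basic invariant that is not of the form `P (top j)`. -/
lemma CoxeterSetup.sum_apply_of_ne_top (cox : CoxeterSetup ℓ t)
    (DFi : Fin t → Derivation ℝ (Ffield ℓ) (Ffield ℓ))
    (hDFi : ∀ i c, DFi i (toF (cox.P c)) = if c = cox.top i then 1 else 0) {c : Fin ℓ}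
    (hc : ∀ j, c ≠ cox.top j) : (∑ i, DFi i) (toF (cox.P c)) = 0 := by
  simp [Derivation.finsetSum_apply, hDFi, hc]

/-- Lemma 2.5: `R = T[P[i]]` for every irreducible factor `i`. -/
theorem stmt4 (cox : CoxeterSetup ℓ t)
    (DFi : Fin t → Derivation ℝ (Ffield ℓ) (Ffield ℓ))
    (hDFi : ∀ i c, DFi i (toF (cox.P c)) = if c = cox.top i then 1 else 0)
    (D : Derivation ℝ (Ffield ℓ) (Ffield ℓ)) (hD : D = ∑ i, DFi i) :
    ∀ i : Fin t,
      (Subring.closure (TF cox.W D ∪ {toF (cox.P (cox.top i))}) : Set (Ffield ℓ))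
        = RF cox.W := by
  intro i
  apply Set.Subset.antisymm
  · rw [← coe_map_invSubring, SetLike.coe_subset_coe, Subring.closure_le, Set.union_subset_iff,
      Set.singleton_subset_iff, coe_map_invSubring]
    exact ⟨fun _ hy => hy.1, Set.mem_image_of_mem _ (cox.hPinv _)⟩
  · rintro _ ⟨p, hp, rfl⟩
    rw [SetLike.mem_coe]
    have hT {y} (hy : y ∈ TF cox.W D) :
        y ∈ Subring.closure (TF cox.W D ∪ {toF (cox.P (cox.top i))}) :=
      Subring.subset_closure (Or.inl hy)
    have htop : toF (cox.P (cox.top i)) ∈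
        Subring.closure (TF cox.W D ∪ {toF (cox.P (cox.top i))}) :=
      Subring.subset_closure (Or.inr rfl)
    induction (cox.hPgen p).1 hp using Algebra.adjoin_induction with
    | mem x hx =>
      obtain ⟨c, rfl⟩ := hx
      by_cases hc : ∃ j, c = cox.top j
      · obtain ⟨j, rfl⟩ := hc
        rw [← sub_add_cancel (toF (cox.P (cox.top j))) (toF (cox.P (cox.top i)))]
        refine add_mem (hT ⟨⟨_, (invSubring cox.W).sub_mem (cox.hPinv (cox.top j))
          (cox.hPinv (cox.top i)), toF_sub _ _⟩, ?_⟩) htop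
        rw [map_sub, hD, cox.sum_apply_top DFi hDFi, cox.sum_apply_top DFi hDFi, sub_self]
      · push Not at hc
        exact hT ⟨⟨_, cox.hPinv c, rfl⟩, hD ▸ cox.sum_apply_of_ne_top DFi hDFi hc⟩
    | algebraMap r =>
      refine hT ⟨⟨_, fun g _ => AlgHom.commutes _ r, rfl⟩, ?_⟩
      rw [toF_algebraMap, Derivation.map_algebraMap]
    | add x y hx hy ihx ihy =>
      rw [toF_add]
      exact add_mem (ihx ((cox.hPgen x).2 hx)) (ihy ((cox.hPgen y).2 hy))
    | mul x y hx hy ihx ihy =>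
      rw [toF_mul]
      exact mul_mem (ihx ((cox.hPgen x).2 hx)) (ihy ((cox.hPgen y).2 hy))

end Statements
end
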